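/- Fix k ≥ 2 and, for 2 ≤ l ≤ k, define in the group algebra ℚ[S_k] the element B⁺_l := (1/l!) • (1 + (l−1) • t_{l−1,l}) * (1 + (l−2) • t_{l−2,l−1}) * ⋯ * (1 + 1 • t_{1,2}). Then the full symmetrizer satisfies S_k = B⁺_2 * B⁺_3 * ⋯ * B⁺_k. -/

import Mathlib

/-- The full symmetrizer `S_k = (1/k!) Σ_σ σ` in `ℚ[S_k]`. -/
noncomputable def symmetrizer (k : ℕ) : MonoidAlgebra ℚ (Equiv.Perm (Fin k)) :=
  ((k.factorial : ℚ))⁻¹ •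
    ∑ σ : Equiv.Perm (Fin k),
      MonoidAlgebra.of ℚ (Equiv.Perm (Fin k)) σ

/-- The transposition `t_{i,j}` of the `i`-th and `j`-th points (1-based labels),
as an element of the group algebra `ℚ[S_k]`.  (For labels out of range it is
defined to be the identity; all uses below are in range.) -/
noncomputable def transposition (k i j : ℕ) : MonoidAlgebra ℚ (Equiv.Perm (Fin k)) :=
  MonoidAlgebra.of ℚ (Equiv.Perm (Fin k))
    (if h : 1 ≤ i ∧ i ≤ k ∧ 1 ≤ j ∧ j ≤ k then
      Equiv.swap ⟨i - 1, by omega⟩ ⟨j - 1, by omega⟩ else 1)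

/-- `B⁺_l = (1/l!) • (1 + (l−1) • t_{l−1,l}) * (1 + (l−2) • t_{l−2,l−1}) * ⋯ * (1 + 1 • t_{1,2})`
in `ℚ[S_k]`: the `m`-th factor (for `m = 0, …, l-2`) is `1 + (l−1−m) • t_{l−1−m, l−m}`. -/
noncomputable def Bplus (k l : ℕ) : MonoidAlgebra ℚ (Equiv.Perm (Fin k)) :=
  ((l.factorial : ℚ))⁻¹ •
    ((List.range (l - 1)).map (fun m =>
      (1 : MonoidAlgebra ℚ (Equiv.Perm (Fin k))) +
        ((l - 1 - m : ℕ) : ℚ) • transposition k (l - 1 - m) (l - m))).prod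

namespace YangFusion

variable {A : Type*} [Ring A] [Algebra ℚ A]

/-- The unnormalized factor `(1 + n • s n) * ⋯ * (1 + 1 • s 1)`. -/
def descProd (s : ℕ → A) : ℕ → A
  | 0 => 1
  | n + 1 => (1 + ((n + 1 : ℕ) : ℚ) • s (n + 1)) * descProd s n

/-- The product of the normalized factors `((m + 1)!)⁻¹ • descProd s m` for `m = 1, …, n`. -/
def fused (s : ℕ → A) : ℕ → A
  | 0 => 1
  | n + 1 => fused s n * (((n + 2).factorial : ℚ)⁻¹ • descProd s (n + 1))

/-- The Coxeter relations of type `A` for the generators `s 1, …, s N`. -/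
structure CoxeterRelations (s : ℕ → A) (N : ℕ) : Prop where
  sq : ∀ i, 1 ≤ i → i ≤ N → s i * s i = 1
  braid : ∀ i, 1 ≤ i → i + 1 ≤ N → s i * s (i + 1) * s i = s (i + 1) * s i * s (i + 1)
  comm : ∀ i j, 1 ≤ i → i + 2 ≤ j → j ≤ N → Commute (s i) (s j)

theorem descProd_mul (s : ℕ → A) (x : A) (n : ℕ) (h : ∀ i, 1 ≤ i → i ≤ n → s i * x = x) :
    descProd s n * x = ((n + 1).factorial : ℚ) • x := by
  induction n with
  | zero => simp [descProd]
  | succ n ih =>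
    rw [descProd, mul_assoc, ih fun i h1 h2 => h i h1 (by omega), mul_smul_comm, add_mul,
      smul_mul_assoc, h (n + 1) (by omega) le_rfl, Nat.factorial_succ (n + 1), one_mul]
    push_cast
    module

theorem mul_descProd (s : ℕ → A) (x : A) (n : ℕ) (h : ∀ i, 1 ≤ i → i ≤ n → x * s i = x) :
    x * descProd s n = ((n + 1).factorial : ℚ) • x := by
  induction n with
  | zero => simp [descProd]
  | succ n ih =>
    have hx : x * (1 + ((n + 1 : ℕ) : ℚ) • s (n + 1)) = ((n + 2 : ℕ) : ℚ) • x := by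
      rw [mul_add, mul_smul_comm, h (n + 1) (by omega) le_rfl, mul_one]
      push_cast
      module
    rw [descProd, ← mul_assoc, hx, smul_mul_assoc, ih fun i h1 h2 => h i h1 (by omega), smul_smul,
      Nat.factorial_succ (n + 1)]
    push_cast
    ring_nf

theorem fused_mul (s : ℕ → A) (x : A) (n : ℕ) (h : ∀ i, 1 ≤ i → i ≤ n → s i * x = x) :
    fused s n * x = x := by
  induction n with
  | zero => simp [fused]
  | succ n ih =>
    rw [fused, mul_assoc, smul_mul_assoc, descProd_mul s x (n + 1) h,
      inv_smul_smul₀ (by exact_mod_cast Nat.factorial_ne_zero _)]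
    exact ih fun i h1 h2 => h i h1 (by omega)

theorem mul_fused (s : ℕ → A) (x : A) (n : ℕ) (h : ∀ i, 1 ≤ i → i ≤ n → x * s i = x) :
    x * fused s n = x := by
  induction n with
  | zero => simp [fused]
  | succ n ih =>
    rw [fused, ← mul_assoc, ih fun i h1 h2 => h i h1 (by omega), mul_smul_comm,
      mul_descProd s x (n + 1) h, inv_smul_smul₀ (by exact_mod_cast Nat.factorial_ne_zero _)]

theorem commute_descProd {s : ℕ → A} {N : ℕ} (hs : CoxeterRelations s N) {n j : ℕ}
    (hj : n + 2 ≤ j) (hN : j ≤ N) : Commute (descProd s n) (s j) := by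
  induction n with
  | zero => exact Commute.one_left _
  | succ n ih =>
    refine Commute.mul_left (Commute.add_left (Commute.one_left _) ?_) (ih (by omega))
    exact (hs.comm (n + 1) j (by omega) (by omega) hN).smul_left _

theorem commute_fused {s : ℕ → A} {N : ℕ} (hs : CoxeterRelations s N) {n j : ℕ}
    (hj : n + 2 ≤ j) (hN : j ≤ N) : Commute (fused s n) (s j) := by
  induction n with
  | zero => exact Commute.one_left _
  | succ n ih =>
    exact Commute.mul_left (ih (by omega)) ((commute_descProd hs hj hN).smul_left _)

/-- The fusion step: if `Q` is built from `P` and `s`, then `Q * (1 + c • t) * Q` absorbs `t`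
on the left. -/
theorem mul_fusion {P Q s t : A} {c : ℚ} (hc : c ≠ 0) (hPQ : P * Q = Q)
    (hPt : Commute P t) (hsQ : s * Q = Q) (ht : t * t = 1) (hst : s * t * s = t * s * t)
    (hQ : c • Q = P * (1 + (c - 1) • s) * P) :
    t * (Q * (1 + c • t) * Q) = Q * (1 + c • t) * Q := by
  have hPtQ : P * (t * Q) = t * Q := by rw [← mul_assoc, hPt.eq, mul_assoc, hPQ]
  have key : Q * (1 + c • t) * Q = P * (Q + t * Q + (c - 1) • (s * (t * Q))) := by
    apply smul_right_injective A hc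
    calc c • (Q * (1 + c • t) * Q) = (c • Q) * (Q + c • (t * Q)) := by
          simp only [mul_add, add_mul, mul_one, smul_mul_assoc, mul_smul_comm, smul_add, mul_assoc]
      _ = P * ((1 + (c - 1) • s) * (Q + c • (t * Q))) := by
          rw [hQ, mul_assoc, mul_assoc, mul_add P Q, mul_smul_comm, hPQ, hPtQ]
      _ = P * (c • (Q + t * Q + (c - 1) • (s * (t * Q)))) := by
          congr 1
          simp only [mul_add, add_mul, one_mul, smul_mul_assoc, mul_smul_comm, hsQ]
          module
      _ = _ := mul_smul_comm _ _ _
  have hstQ : t * (s * (t * Q)) = s * (t * Q) := by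
    rw [← mul_assoc, ← mul_assoc, ← hst, mul_assoc, hsQ, mul_assoc]
  rw [key, ← mul_assoc, ← hPt.eq, mul_assoc]
  simp only [mul_add t, mul_smul_comm, hstQ]
  rw [← mul_assoc t t Q, ht, one_mul, add_comm (t * Q)]

/-- The mirror image of `mul_fusion`. -/
theorem fusion_mul {P Q s t : A} {c : ℚ} (hc : c ≠ 0) (hQP : Q * P = Q)
    (hPt : Commute P t) (hQs : Q * s = Q) (ht : t * t = 1) (hst : s * t * s = t * s * t)
    (hQ : c • Q = P * (1 + (c - 1) • s) * P) :
    Q * (1 + c • t) * Q * t = Q * (1 + c • t) * Q := by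
  open MulOpposite in
  have := mul_fusion (P := op P) (Q := op Q) (s := op s) (t := op t) hc
    (congrArg op hQP) hPt.op (congrArg op hQs) (congrArg op ht)
    (by simpa only [op_mul, mul_assoc] using congrArg op hst)
    (by simpa only [op_mul, op_add, op_smul, op_one, mul_assoc] using congrArg op hQ)
  apply MulOpposite.op_injective
  simpa only [MulOpposite.op_mul, MulOpposite.op_add, MulOpposite.op_smul, MulOpposite.op_one,
    mul_assoc] using this

/-- `fused s n` absorbs the generators `s 1, …, s n` on both sides. -/
def Absorbs (s : ℕ → A) (n : ℕ) : Prop :=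
  ∀ i, 1 ≤ i → i ≤ n → s i * fused s n = fused s n ∧ fused s n * s i = fused s n

theorem smul_fused_succ {s : ℕ → A} {N : ℕ} (hs : CoxeterRelations s N) {n : ℕ}
    (hn : n + 2 ≤ N) (h' : Absorbs s (n + 1)) :
    ((n + 3 : ℕ) : ℚ) • fused s (n + 2) =
      fused s (n + 1) * (1 + ((n + 2 : ℕ) : ℚ) • s (n + 2)) * fused s (n + 1) := by
  have hcomm : Commute (fused s n) (1 + ((n + 2 : ℕ) : ℚ) • s (n + 2)) :=
    (Commute.one_right _).add_right ((commute_fused hs le_rfl hn).smul_right _)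
  have hEE : fused s (n + 1) * fused s n = fused s (n + 1) :=
    mul_fused s _ n fun i h1 h2 => (h' i h1 (by omega)).2
  have hEC : fused s n * descProd s (n + 1) = ((n + 2).factorial : ℚ) • fused s (n + 1) := by
    rw [fused, mul_smul_comm, smul_inv_smul₀ (by exact_mod_cast Nat.factorial_ne_zero _)]
  have hscalar : ((n + 3 : ℕ) : ℚ) * ((n + 3).factorial : ℚ)⁻¹ * ((n + 2).factorial : ℚ) = 1 := by
    rw [Nat.factorial_succ (n + 2)]
    have : ((n + 2).factorial : ℚ) ≠ 0 := by exact_mod_cast Nat.factorial_ne_zero _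
    push_cast
    field_simp
    ring
  rw [fused, descProd, mul_smul_comm, ← mul_assoc]
  nth_rewrite 1 [← hEE]
  rw [mul_assoc (fused s (n + 1)), hcomm.eq, ← mul_assoc (fused s (n + 1)), mul_assoc _ (fused s n),
    hEC, mul_smul_comm, smul_smul, smul_smul, hscalar, one_smul]

theorem absorbs_of_smul_eq {s : ℕ → A} {n : ℕ} (h : Absorbs s n) {x : A} {c : ℚ} (hc : c ≠ 0)
    (hE : c • fused s (n + 1) = fused s n * x * fused s n)
    (hl : s (n + 1) * (fused s n * x * fused s n) = fused s n * x * fused s n)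
    (hr : fused s n * x * fused s n * s (n + 1) = fused s n * x * fused s n) :
    Absorbs s (n + 1) := by
  intro i h1 h2
  rcases Nat.lt_or_ge n i with hi | hi
  · obtain rfl : i = n + 1 := by omega
    constructor <;> apply smul_right_injective A hc
    · simpa only [← mul_smul_comm, hE] using hl
    · simpa only [← smul_mul_assoc, hE] using hr
  · constructor <;> apply smul_right_injective A hc
    · simp only [← mul_smul_comm, hE]
      rw [← mul_assoc, ← mul_assoc, (h i h1 hi).1]
    · simp only [← smul_mul_assoc, hE]
      rw [mul_assoc, (h i h1 hi).2]

theorem absorbs_succ_and_smul_fused {s : ℕ → A} {N : ℕ} (hs : CoxeterRelations s N) (n : ℕ)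
    (hn : n + 1 ≤ N) :
    Absorbs s (n + 1) ∧ ((n + 2 : ℕ) : ℚ) • fused s (n + 1) =
      fused s n * (1 + ((n + 1 : ℕ) : ℚ) • s (n + 1)) * fused s n := by
  induction n with
  | zero =>
    have h0 : Absorbs s 0 := fun i h1 h2 => by omega
    have hE : ((0 + 2 : ℕ) : ℚ) • fused s (0 + 1) =
        fused s 0 * (1 + ((0 + 1 : ℕ) : ℚ) • s (0 + 1)) * fused s 0 := by
      simp [fused, descProd]
    have hsq := hs.sq 1 le_rfl hn
    refine ⟨absorbs_of_smul_eq h0 (by norm_num) hE ?_ ?_, hE⟩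
    · simp [fused, mul_add, hsq, add_comm]
    · simp [fused, add_mul, hsq, add_comm]
  | succ n ih =>
    obtain ⟨h', hE⟩ := ih (by omega)
    have hE' := smul_fused_succ hs hn h'
    have hc : ((n + 2 : ℕ) : ℚ) ≠ 0 := by positivity
    have hPt := commute_fused hs (n := n) le_rfl hn
    have ht := hs.sq (n + 2) (by omega) hn
    have hst := hs.braid (n + 1) (by omega) hn
    have hQ : ((n + 2 : ℕ) : ℚ) • fused s (n + 1) =
        fused s n * (1 + (((n + 2 : ℕ) : ℚ) - 1) • s (n + 1)) * fused s n := by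
      rw [hE]
      push_cast
      ring_nf
    have hs' := h' (n + 1) (by omega) le_rfl
    refine ⟨absorbs_of_smul_eq h' (by positivity) hE' ?_ ?_, hE'⟩
    · exact mul_fusion hc (fused_mul s _ n fun i h1 h2 => (h' i h1 (by omega)).1)
        hPt hs'.1 ht hst hQ
    · exact fusion_mul hc (mul_fused s _ n fun i h1 h2 => (h' i h1 (by omega)).2)
        hPt hs'.2 ht hst hQ

theorem descProd_eq_prod (s : ℕ → A) (n : ℕ) :
    descProd s n =
      ((List.range n).map fun m => (1 : A) + ((n - m : ℕ) : ℚ) • s (n - m)).prod := by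
  induction n with
  | zero => rfl
  | succ n ih =>
    rw [descProd, ih, List.range_succ_eq_map]
    simp [Function.comp_def]

theorem fused_eq_prod (s : ℕ → A) (n : ℕ) :
    fused s n = ((List.range n).map fun i =>
      (((i + 2).factorial : ℚ)⁻¹ • descProd s (i + 1))).prod := by
  induction n with
  | zero => rfl
  | succ n ih => rw [fused, ih, List.range_succ, List.map_append, List.prod_append]; simp

end YangFusion

open YangFusion

theorem transposition_eq_of (k i : ℕ) (h1 : 1 ≤ i) (h2 : i < k) :
    transposition k i (i + 1) =
      MonoidAlgebra.of ℚ _ (Equiv.swap (⟨i - 1, by omega⟩ : Fin k) ⟨i, h2⟩) := by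
  rw [transposition, dif_pos (by omega)]
  simp

theorem swap_braid {α : Type*} [DecidableEq α] {a b c : α} (hab : a ≠ b) (hac : a ≠ c)
    (hbc : b ≠ c) : Equiv.swap a b * Equiv.swap b c * Equiv.swap a b =
      Equiv.swap b c * Equiv.swap a b * Equiv.swap b c := by
  rw [Equiv.swap_mul_swap_mul_swap hab hac, Equiv.swap_comm a b, Equiv.swap_comm b c,
    Equiv.swap_mul_swap_mul_swap hbc.symm hac.symm, Equiv.swap_comm]

theorem coxeterRelations_transposition (k : ℕ) :
    CoxeterRelations (fun i => transposition k i (i + 1)) (k - 1) where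
  sq i h1 h2 := by
    rw [transposition_eq_of k i h1 (by omega), ← map_mul, Equiv.swap_mul_self, map_one]
  braid i h1 h2 := by
    simp only [transposition_eq_of k i h1 (by omega),
      transposition_eq_of k (i + 1) (by omega) (by omega), ← map_mul, Nat.add_sub_cancel]
    rw [swap_braid (by simp; omega) (by simp only [ne_eq, Fin.mk.injEq]; omega) (by simp)]
  comm i j h1 h2 h3 := by
    rw [transposition_eq_of k i h1 (by omega),
      transposition_eq_of k j (by omega) (by omega)]
    refine Commute.map (Equiv.Perm.Disjoint.commute ?_) _
    apply Equiv.Perm.disjoint_swap_swap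
    simp
    omega

theorem Bplus_eq_descProd (k n : ℕ) :
    Bplus k (n + 2) = ((n + 2).factorial : ℚ)⁻¹ •
      descProd (fun i => transposition k i (i + 1)) (n + 1) := by
  rw [Bplus, descProd_eq_prod]
  congr 2
  refine List.map_congr_left fun m hm => ?_
  rw [List.mem_range] at hm
  rw [show n + 2 - 1 - m = n + 1 - m by omega, show n + 2 - m = n + 1 - m + 1 by omega]

theorem symmetrizer_mul_of (k : ℕ) (τ : Equiv.Perm (Fin k)) :
    symmetrizer k * MonoidAlgebra.of ℚ _ τ = symmetrizer k := by
  simp only [symmetrizer, smul_mul_assoc, Finset.sum_mul, ← map_mul]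
  congr 1
  exact Fintype.sum_equiv (Equiv.mulRight τ) _ _ fun _ => rfl

theorem symmetrizer_mul_of_forall (k : ℕ) (x : MonoidAlgebra ℚ (Equiv.Perm (Fin k)))
    (h : ∀ σ, MonoidAlgebra.of ℚ _ σ * x = x) : symmetrizer k * x = x := by
  simp only [symmetrizer, smul_mul_assoc, Finset.sum_mul, h, Finset.sum_const, Finset.card_univ,
    Fintype.card_perm, Fintype.card_fin]
  rw [← Nat.cast_smul_eq_nsmul ℚ, inv_smul_smul₀ (by exact_mod_cast Nat.factorial_ne_zero _)]

theorem of_mul_eq_self_of_adjacent {k : ℕ} (x : MonoidAlgebra ℚ (Equiv.Perm (Fin k)))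
    (h : ∀ i, 1 ≤ i → i ≤ k - 1 → transposition k i (i + 1) * x = x) (σ : Equiv.Perm (Fin k)) :
    MonoidAlgebra.of ℚ _ σ * x = x := by
  obtain _ | n := k
  · rw [Subsingleton.elim σ 1, map_one, one_mul]
  have hσ : σ ∈ Submonoid.closure
      (Set.range fun i : Fin n => Equiv.swap i.castSucc i.succ) := by
    rw [Equiv.Perm.mclosure_swap_castSucc_succ]
    trivial
  induction hσ using Submonoid.closure_induction with
  | mem _ hτ =>
    obtain ⟨i, rfl⟩ := hτ
    have := h (i + 1) (by omega) (by omega)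
    rwa [transposition_eq_of _ _ (by omega) (by omega)] at this
  | one => rw [map_one, one_mul]
  | mul τ ρ _ _ hτ hρ => rw [map_mul, mul_assoc, hρ, hτ]

/-- The full symmetrizer factors as `S_k = B⁺_2 * B⁺_3 * ⋯ * B⁺_k`. -/
theorem symmetrizer_eq_prod_Bplus (k : ℕ) (hk : 2 ≤ k) :
    symmetrizer k = ((List.range (k - 1)).map (fun i => Bplus k (i + 2))).prod := by
  simp only [Bplus_eq_descProd]
  rw [← fused_eq_prod]
  obtain ⟨n, rfl⟩ := Nat.exists_eq_add_of_le' hk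
  obtain ⟨habs, -⟩ := absorbs_succ_and_smul_fused (coxeterRelations_transposition (n + 2)) n
    (by omega)
  have hleft := symmetrizer_mul_of_forall (n + 2) _
    (of_mul_eq_self_of_adjacent _ fun i h1 h2 => (habs i h1 h2).1)
  have hright := mul_fused (fun i => transposition (n + 2) i (i + 1)) (symmetrizer (n + 2)) (n + 1)
    fun i _ _ => symmetrizer_mul_of _ _
  exact hright.symm.trans hleft
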